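/- arXiv:1001.0176 — 2 statements merged into one kernel-verified Lean document; each statement's English description precedes it below -/
import Mathlib

section
/- Let A and B be finite-dimensional Lie algebras over a field. Then dim M(A ⊕ B) = dim M(A) + dim M(B) + dim((A/A²) ⊗ (B/B²)). -/
open Module

instance Prod.instLieRingBracket (L M : Type*) [LieRing L] [LieRing M] :
    Bracket (L × M) (L × M) :=
  ⟨fun x y => (⁅x.1, y.1⁆, ⁅x.2, y.2⁆)⟩

/-- Direct sum (product) of two Lie rings. -/
instance Prod.instLieRing (L M : Type*) [LieRing L] [LieRing M] : LieRing (L × M) where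
  add_lie x y z := by ext <;> simp [Bracket.bracket, add_lie]
  lie_add x y z := by ext <;> simp [Bracket.bracket, lie_add]
  lie_self x := by ext <;> simp [Bracket.bracket]
  leibniz_lie x y z := by ext <;> simp [Bracket.bracket]

instance Prod.instLieAlgebra (k L M : Type*) [CommRing k] [LieRing L] [LieRing M]
    [LieAlgebra k L] [LieAlgebra k M] : LieAlgebra k (L × M) where
  lie_smul t x y := by ext <;> simp [Bracket.bracket, lie_smul]

section Schur
variable (k : Type*) [Field k] (L : Type*) [LieRing L] [LieAlgebra k L]

/-- The canonical free presentation map `FreeLieAlgebra k L → L`. -/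
noncomputable def presPi : FreeLieAlgebra k L →ₗ⁅k⁆ L := FreeLieAlgebra.lift k id

/-- `R ∩ F²` for the canonical free presentation `0 → R → F → L → 0`. -/
noncomputable def multNum : LieIdeal k (FreeLieAlgebra k L) :=
  (presPi k L).ker ⊓ ⁅(⊤ : LieIdeal k (FreeLieAlgebra k L)), (⊤ : LieIdeal k (FreeLieAlgebra k L))⁆

/-- `[R, F]` for the canonical free presentation. -/
noncomputable def multDen : LieIdeal k (FreeLieAlgebra k L) :=
  ⁅(presPi k L).ker, (⊤ : LieIdeal k (FreeLieAlgebra k L))⁆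

/-- The Schur multiplier `M(L) = (R ∩ F²)/[R,F]`, as a Lie algebra (it is abelian). -/
noncomputable def schurMultiplier :=
  (↥(multNum k L)) ⧸ (LieIdeal.comap ((multNum k L) : LieSubalgebra k (FreeLieAlgebra k L)).incl
    (multDen k L))

noncomputable instance : LieRing (schurMultiplier k L) := by unfold schurMultiplier; infer_instance
noncomputable instance : LieAlgebra k (schurMultiplier k L) := by
  unfold schurMultiplier; infer_instance
noncomputable instance : Module k (schurMultiplier k L) := by
  unfold schurMultiplier; infer_instance

/-- dim M(L). -/
noncomputable def schurMultDim : ℕ := Module.finrank k (schurMultiplier k L)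

/-- The derived subalgebra `L² = [L,L]` as an ideal. -/
noncomputable def derivedIdeal : LieIdeal k L := ⁅(⊤ : LieIdeal k L), (⊤ : LieIdeal k L)⁆

end Schur


/-- Scalar 2-cocycles of a Lie algebra. -/
def Z2 (k : Type*) [Field k] (L : Type*) [LieRing L] [LieAlgebra k L] :
    Submodule k (L →ₗ[k] L →ₗ[k] k) where
  carrier := {f | (∀ x, f x x = 0) ∧ ∀ x y z, f x ⁅y, z⁆ + f y ⁅z, x⁆ + f z ⁅x, y⁆ = 0}
  add_mem' := by
    rintro f g ⟨hf, hf'⟩ ⟨hg, hg'⟩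
    refine ⟨fun x => by simp [hf, hg], fun x y z => ?_⟩
    have h1 := hf' x y z
    have h2 := hg' x y z
    simp only [LinearMap.add_apply]
    linear_combination h1 + h2
  zero_mem' := by simp
  smul_mem' := by
    rintro c f ⟨hf, hf'⟩
    refine ⟨fun x => by simp [hf], fun x y z => ?_⟩
    have h1 := hf' x y z
    simp only [LinearMap.smul_apply, smul_eq_mul]
    linear_combination c * h1

section Ext
variable {k : Type*} [Field k] {L : Type*} [LieRing L] [LieAlgebra k L]

/-- Underlying space of the central extension of `L` by `k` given by a cocycle. -/
def CExt (_f : Z2 k L) : Type _ := L × k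

instance (f : Z2 k L) : AddCommGroup (CExt f) := inferInstanceAs (AddCommGroup (L × k))
instance (f : Z2 k L) : Module k (CExt f) := inferInstanceAs (Module k (L × k))

instance (f : Z2 k L) : Bracket (CExt f) (CExt f) :=
  ⟨fun x y => ((⁅x.1, y.1⁆, f.1 x.1 y.1) : L × k)⟩

theorem CExt.ext' {f : Z2 k L} {x y : CExt f} (h1 : x.1 = y.1) (h2 : x.2 = y.2) : x = y :=
  Prod.ext h1 h2

theorem CExt.fst_lie {f : Z2 k L} (x y : CExt f) : (⁅x, y⁆ : CExt f).1 = ⁅x.1, y.1⁆ := rfl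
theorem CExt.snd_lie {f : Z2 k L} (x y : CExt f) : (⁅x, y⁆ : CExt f).2 = f.1 x.1 y.1 := rfl
theorem CExt.fst_add {f : Z2 k L} (x y : CExt f) : (x + y).1 = x.1 + y.1 := rfl
theorem CExt.snd_add {f : Z2 k L} (x y : CExt f) : (x + y).2 = x.2 + y.2 := rfl
theorem CExt.fst_smul {f : Z2 k L} (c : k) (x : CExt f) : (c • x).1 = c • x.1 := rfl
theorem CExt.snd_smul {f : Z2 k L} (c : k) (x : CExt f) : (c • x).2 = c * x.2 := rfl

theorem Z2.skew (f : Z2 k L) (x y : L) : f.1 x y = - f.1 y x := by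
  have h := f.2.1 (x + y)
  simp only [map_add, LinearMap.add_apply, f.2.1 x, f.2.1 y] at h
  linear_combination h

instance (f : Z2 k L) : LieRing (CExt f) where
  add_lie x y z := CExt.ext' (by simp only [CExt.fst_lie, CExt.fst_add, add_lie])
    (by simp [CExt.fst_lie, CExt.fst_add, CExt.snd_lie, CExt.snd_add])
  lie_add x y z := CExt.ext' (by simp only [CExt.fst_lie, CExt.fst_add, lie_add])
    (by simp [CExt.fst_lie, CExt.fst_add, CExt.snd_lie, CExt.snd_add])
  lie_self x := CExt.ext' (by simp only [CExt.fst_lie, lie_self]; rfl)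
    (by simp only [CExt.snd_lie, f.2.1]; rfl)
  leibniz_lie x y z := CExt.ext'
    (by simp only [CExt.fst_lie, CExt.fst_add]; exact leibniz_lie _ _ _)
    (by
      simp only [CExt.fst_lie, CExt.snd_lie, CExt.snd_add]
      have h := f.2.2 x.1 y.1 z.1
      rw [← lie_skew z.1 x.1, map_neg] at h
      rw [Z2.skew f ⁅x.1, y.1⁆]
      linear_combination h)

instance (f : Z2 k L) : LieAlgebra k (CExt f) where
  lie_smul t x y := CExt.ext' (by simp only [CExt.fst_lie, CExt.fst_smul, lie_smul])
    (by simp [CExt.fst_smul, CExt.snd_lie, CExt.snd_smul])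

/-- The projection of the central extension. -/
def CExt.fstHom (f : Z2 k L) : CExt f →ₗ⁅k⁆ L where
  toFun x := x.1
  map_add' _ _ := rfl
  map_smul' _ _ := rfl
  map_lie' := rfl

/-- The second coordinate of the central extension. -/
def CExt.sndLin (f : Z2 k L) : CExt f →ₗ[k] k where
  toFun x := x.2
  map_add' _ _ := rfl
  map_smul' _ _ := rfl

/-- Lift of the free Lie algebra to the central extension. -/
noncomputable def toExt (f : Z2 k L) : FreeLieAlgebra k L →ₗ⁅k⁆ CExt f :=
  FreeLieAlgebra.lift k (fun x : L => (((x, 0) : L × k) : CExt f))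

theorem toExt_fst (f : Z2 k L) (u : FreeLieAlgebra k L) : (toExt f u).1 = presPi k L u := by
  have : (CExt.fstHom f).comp (toExt f) = presPi k L := by
    apply FreeLieAlgebra.hom_ext
    intro x
    rw [LieHom.comp_apply, toExt, presPi, FreeLieAlgebra.lift_of_apply]
    exact congrArg (CExt.fstHom f) (FreeLieAlgebra.lift_of_apply _ x)
  exact DFunLike.congr_fun this u

/-- The functional on the free Lie algebra associated with a cocycle. -/
noncomputable def coc (f : Z2 k L) : FreeLieAlgebra k L →ₗ[k] k :=
  (CExt.sndLin f) ∘ₗ (toExt f : FreeLieAlgebra k L →ₗ[k] CExt f)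

theorem coc_lie (f : Z2 k L) (u v : FreeLieAlgebra k L) :
    coc f ⁅u, v⁆ = f.1 (presPi k L u) (presPi k L v) := by
  rw [← toExt_fst f, ← toExt_fst f, ← CExt.snd_lie, ← LieHom.map_lie]
  rfl

variable (k L) in
/-- The derived algebra of the free Lie algebra, as a subspace. -/
noncomputable def F2 : Submodule k (FreeLieAlgebra k L) :=
  (derivedIdeal k (FreeLieAlgebra k L)).toSubmodule

variable (k L) in
/-- `[R,F]`, as a subspace. -/
noncomputable def RF : Submodule k (FreeLieAlgebra k L) := (multDen k L).toSubmodule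

theorem derived_span (M : Type*) [LieRing M] [LieAlgebra k M] :
    (derivedIdeal k M).toSubmodule = Submodule.span k {m | ∃ x y : M, ⁅x, y⁆ = m} := by
  rw [derivedIdeal, LieSubmodule.lieIdeal_oper_eq_linear_span']
  simp

theorem RF_span : RF k L = Submodule.span k {m | ∃ x y : FreeLieAlgebra k L,
    presPi k L x = 0 ∧ ⁅x, y⁆ = m} := by
  rw [RF, multDen, LieSubmodule.lieIdeal_oper_eq_linear_span']
  simp

theorem lie_mem_F2 (u v : FreeLieAlgebra k L) : ⁅u, v⁆ ∈ F2 k L := by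
  rw [F2, derived_span]; exact Submodule.subset_span ⟨u, v, rfl⟩

theorem lie_mem_RF (u v : FreeLieAlgebra k L) (h : presPi k L u = 0) : ⁅u, v⁆ ∈ RF k L := by
  rw [RF_span]; exact Submodule.subset_span ⟨u, v, h, rfl⟩

theorem lie_mem_RF' (u v : FreeLieAlgebra k L) (h : presPi k L v = 0) : ⁅u, v⁆ ∈ RF k L := by
  rw [← lie_skew]; exact Submodule.neg_mem _ (lie_mem_RF v u h)

theorem RF_le_F2 : RF k L ≤ F2 k L := by
  rw [RF_span, Submodule.span_le]
  rintro _ ⟨x, y, -, rfl⟩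
  exact lie_mem_F2 x y

theorem RF_le_ker : RF k L ≤ LinearMap.ker (presPi k L : FreeLieAlgebra k L →ₗ[k] L) := by
  rw [RF_span, Submodule.span_le]
  rintro _ ⟨x, y, h, rfl⟩
  simp [h]

theorem coc_RF (f : Z2 k L) : RF k L ≤ LinearMap.ker (coc f) := by
  rw [RF_span, Submodule.span_le]
  rintro _ ⟨x, y, h, rfl⟩
  simp [coc_lie, h]

variable (k L) in
/-- `F²/[R,F]`. -/
abbrev VV : Type _ := F2 k L ⧸ (RF k L).comap (F2 k L).subtype

/-- class of a bracket. -/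
noncomputable def brq (u v : FreeLieAlgebra k L) : VV k L :=
  Submodule.Quotient.mk ⟨⁅u, v⁆, lie_mem_F2 u v⟩

theorem brq_congr {u u' v v' : FreeLieAlgebra k L} (h : presPi k L u = presPi k L u')
    (h' : presPi k L v = presPi k L v') : brq u v = brq u' v' := by
  rw [brq, brq, Submodule.Quotient.eq]
  change ⁅u, v⁆ - ⁅u', v'⁆ ∈ RF k L
  have : ⁅u, v⁆ - ⁅u', v'⁆ = ⁅u - u', v⁆ + ⁅u', v - v'⁆ := by simp
  rw [this]
  exact Submodule.add_mem _ (lie_mem_RF _ _ (by simp [h])) (lie_mem_RF' _ _ (by simp [h']))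

theorem presPi_of (x : L) : presPi k L (FreeLieAlgebra.of k x) = x := by
  simp [presPi]

variable (k L) in
/-- The bilinear map `L × L → F²/[R,F]`. -/
noncomputable def beta : L →ₗ[k] L →ₗ[k] VV k L :=
  LinearMap.mk₂ k (fun x y => brq (FreeLieAlgebra.of k x) (FreeLieAlgebra.of k y))
    (fun x x' y => by
      rw [brq_congr (u' := FreeLieAlgebra.of k x + FreeLieAlgebra.of k x')
        (v' := FreeLieAlgebra.of k y) (by simp [presPi_of]) rfl]
      simp only [brq, ← Submodule.Quotient.mk_add]
      congr 1; ext1; simp)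
    (fun c x y => by
      rw [brq_congr (u' := c • FreeLieAlgebra.of k x)
        (v' := FreeLieAlgebra.of k y) (by simp [presPi_of]) rfl]
      simp only [brq, ← Submodule.Quotient.mk_smul]
      congr 1; ext1; simp)
    (fun x y y' => by
      rw [brq_congr (v' := FreeLieAlgebra.of k y + FreeLieAlgebra.of k y')
        (u' := FreeLieAlgebra.of k x) rfl (by simp [presPi_of])]
      simp only [brq, ← Submodule.Quotient.mk_add]
      congr 1; ext1; simp)
    (fun c x y => by
      rw [brq_congr (v' := c • FreeLieAlgebra.of k y)
        (u' := FreeLieAlgebra.of k x) rfl (by simp [presPi_of])]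
      simp only [brq, ← Submodule.Quotient.mk_smul]
      congr 1; ext1; simp)

theorem beta_pi (u v : FreeLieAlgebra k L) : beta k L (presPi k L u) (presPi k L v) = brq u v :=
  brq_congr (presPi_of _) (presPi_of _)

theorem beta_self (x : L) : beta k L x x = 0 := by
  rw [← presPi_of (k := k) x, beta_pi, brq, Submodule.Quotient.mk_eq_zero]
  simp

theorem beta_jac (x y z : L) :
    beta k L x ⁅y, z⁆ + beta k L y ⁅z, x⁆ + beta k L z ⁅x, y⁆ = 0 := by
  rw [← presPi_of (k := k) x, ← presPi_of (k := k) y, ← presPi_of (k := k) z]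
  simp only [← LieHom.map_lie, beta_pi]
  simp only [brq, ← Submodule.Quotient.mk_add]
  rw [Submodule.Quotient.mk_eq_zero]
  change _ + _ + _ ∈ RF k L
  rw [lie_jacobi]
  exact Submodule.zero_mem _

variable (k L) in
/-- Functionals on `F²/[R,F]` are cocycles on `L`. -/
noncomputable def dualToZ2 : (VV k L →ₗ[k] k) →ₗ[k] Z2 k L where
  toFun l := ⟨(beta k L).compr₂ l, fun x => by simp [beta_self], fun x y z => by
    simp only [LinearMap.compr₂_apply, ← map_add, beta_jac, map_zero]⟩
  map_add' _ _ := by ext; simp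
  map_smul' _ _ := by ext; simp

theorem dualToZ2_inj : Function.Injective (dualToZ2 k L) := by
  rw [injective_iff_map_eq_zero]
  intro l hl
  have h : ∀ u v, l (brq u v) = 0 := fun u v => by
    rw [← beta_pi]
    exact LinearMap.congr_fun₂ (congrArg Subtype.val hl) _ _
  apply Submodule.linearMap_qext
  ext ⟨w, hw⟩
  have hw' := hw
  rw [F2, derived_span] at hw'
  suffices ∀ hw : w ∈ F2 k L, l (Submodule.Quotient.mk ⟨w, hw⟩) = 0 from this hw
  induction hw' using Submodule.span_induction with
  | mem x hx => obtain ⟨u, v, rfl⟩ := hx; intro _; exact h u v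
  | zero => intro _; exact map_zero l
  | add x y hx hy ihx ihy =>
    rw [← derived_span] at hx hy
    intro _
    have := congrArg₂ (· + ·) (ihx hx hx) (ihy hy hy)
    simp only [← map_add, ← Submodule.Quotient.mk_add, add_zero] at this
    exact this
  | smul c x hx ihx =>
    rw [← derived_span] at hx
    intro _
    have := congrArg (c • ·) (ihx hx hx)
    simp only [← map_smul, ← Submodule.Quotient.mk_smul, smul_zero] at this
    exact this

theorem dualToZ2_surj : Function.Surjective (dualToZ2 k L) := by
  intro f
  refine ⟨Submodule.liftQ _ ((coc f) ∘ₗ (F2 k L).subtype) ?_, ?_⟩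
  · intro w hw
    exact coc_RF f hw
  · ext x y
    change coc f ⁅FreeLieAlgebra.of k x, FreeLieAlgebra.of k y⁆ = _
    rw [coc_lie, presPi_of, presPi_of]

theorem lin_aux {F : Type*} [AddCommGroup F] [Module k F] (p : F →ₗ[k] L) (D N : Submodule k F)
    (hN : N ≤ LinearMap.ker p) (K : Submodule k F) (hK : K = LinearMap.ker p ⊓ D)
    [FiniteDimensional k (D ⧸ N.comap D.subtype)] :
    finrank k (K ⧸ N.comap K.subtype) + finrank k (D.map p) =
      finrank k (D ⧸ N.comap D.subtype) := by
  subst hK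
  let g : (D ⧸ N.comap D.subtype) →ₗ[k] L := Submodule.liftQ _ (p ∘ₗ D.subtype)
    (fun w hw => hN hw)
  have hr : LinearMap.range g = D.map p := by
    ext y
    constructor
    · rintro ⟨w, rfl⟩
      obtain ⟨⟨d, hd⟩, rfl⟩ := Submodule.Quotient.mk_surjective _ w
      exact ⟨d, hd, rfl⟩
    · rintro ⟨d, hd, rfl⟩
      exact ⟨Submodule.Quotient.mk ⟨d, hd⟩, rfl⟩
  let h0 : ↥(LinearMap.ker p ⊓ D) →ₗ[k] LinearMap.ker g :=
    LinearMap.codRestrict _ ((Submodule.mkQ _) ∘ₗ (Submodule.inclusion inf_le_right))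
      (fun w => w.2.1)
  have hs : Function.Surjective h0 := by
    rintro ⟨w, hw⟩
    obtain ⟨⟨d, hd⟩, rfl⟩ := Submodule.Quotient.mk_surjective _ w
    exact ⟨⟨d, hw, hd⟩, rfl⟩
  have hk : LinearMap.ker h0 = N.comap (LinearMap.ker p ⊓ D).subtype := by
    ext w
    rw [LinearMap.mem_ker, ← Subtype.coe_inj]
    change (Submodule.Quotient.mk _ : D ⧸ N.comap D.subtype) = 0 ↔ _
    rw [Submodule.Quotient.mk_eq_zero]
    rfl
  rw [← hk, (h0.quotKerEquivOfSurjective hs).finrank_eq, ← hr, add_comm]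
  exact LinearMap.finrank_range_add_finrank_ker g

theorem map_F2 : (F2 k L).map (presPi k L : FreeLieAlgebra k L →ₗ[k] L) =
    (derivedIdeal k L).toSubmodule := by
  rw [F2, derived_span, derived_span, Submodule.map_span]
  congr 1
  ext m
  constructor
  · rintro ⟨_, ⟨u, v, rfl⟩, rfl⟩
    exact ⟨presPi k L u, presPi k L v, by simp⟩
  · rintro ⟨x, y, rfl⟩
    exact ⟨_, ⟨FreeLieAlgebra.of k x, FreeLieAlgebra.of k y, rfl⟩, by simp [presPi_of]⟩

variable (k L) in
theorem schur_key [FiniteDimensional k L] :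
    schurMultDim k L + finrank k (derivedIdeal k L).toSubmodule = finrank k (Z2 k L) := by
  let e : Module.Dual k (VV k L) ≃ₗ[k] Z2 k L :=
    LinearEquiv.ofBijective (dualToZ2 k L) ⟨dualToZ2_inj, dualToZ2_surj⟩
  have hfd : FiniteDimensional k (Module.Dual k (VV k L)) := Module.Finite.equiv e.symm
  have hf : FiniteDimensional k (VV k L) := (Module.finite_dual_iff k).1 hfd
  rw [← e.finrank_eq, Subspace.dual_finrank_eq, ← map_F2]
  exact lin_aux (presPi k L : FreeLieAlgebra k L →ₗ[k] L) (F2 k L) (RF k L) RF_le_ker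
    (multNum k L).toSubmodule (by ext w; simp [multNum, F2, derivedIdeal])

end Ext

section ProdPart
variable (k : Type*) [Field k] (A B : Type*) [LieRing A] [LieAlgebra k A]
    [LieRing B] [LieAlgebra k B]

theorem prod_lie (x y : A × B) : ⁅x, y⁆ = (⁅x.1, y.1⁆, ⁅x.2, y.2⁆) := rfl

theorem derived_prod : (derivedIdeal k (A × B)).toSubmodule =
    (derivedIdeal k A).toSubmodule.prod (derivedIdeal k B).toSubmodule := by
  simp only [derived_span]
  apply le_antisymm
  · rw [Submodule.span_le]
    rintro _ ⟨x, y, rfl⟩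
    exact ⟨Submodule.subset_span ⟨x.1, y.1, rfl⟩, Submodule.subset_span ⟨x.2, y.2, rfl⟩⟩
  · rw [Submodule.prod_le_iff, Submodule.map_span, Submodule.map_span, Submodule.span_le,
      Submodule.span_le]
    constructor
    · rintro _ ⟨_, ⟨x, y, rfl⟩, rfl⟩
      exact Submodule.subset_span ⟨(x, 0), (y, 0), by simp [prod_lie]⟩
    · rintro _ ⟨_, ⟨x, y, rfl⟩, rfl⟩
      exact Submodule.subset_span ⟨(0, x), (0, y), by simp [prod_lie]⟩

variable {k A B}

theorem free_sub {k : Type*} [Field k] {V : Type*} [AddCommGroup V] [Module k V]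
    (S : Submodule k V) : Module.Free k S := inferInstance

instance Z2.free : Module.Free k (Z2 k A) :=
  free_sub (V := A →ₗ[k] A →ₗ[k] k) (Z2 k A)

instance Z2.fin [FiniteDimensional k A] : Module.Finite k (Z2 k A) :=
  @FiniteDimensional.finiteDimensional_submodule k (A →ₗ[k] A →ₗ[k] k) _ _ _ _ (Z2 k A)

theorem lie_mem_derived (x y : A) : ⁅x, y⁆ ∈ (derivedIdeal k A).toSubmodule := by
  rw [derived_span]; exact Submodule.subset_span ⟨x, y, rfl⟩

variable (k A) in
/-- The abelianization, as a quotient vector space. -/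
abbrev AbQ : Type _ := A ⧸ (derivedIdeal k A).toSubmodule

variable (k A) in
/-- The projection to the abelianization. -/
noncomputable abbrev qq : A →ₗ[k] AbQ k A := (derivedIdeal k A).toSubmodule.mkQ

theorem qq_lie (x y : A) : qq k A ⁅x, y⁆ = 0 :=
  (Submodule.Quotient.mk_eq_zero _).2 (lie_mem_derived x y)

variable (k A B) in
/-- Assembling a cocycle on a product. -/
noncomputable def asm : (Z2 k A × Z2 k B × (AbQ k A →ₗ[k] AbQ k B →ₗ[k] k)) →ₗ[k] Z2 k (A × B) where
  toFun t := ⟨LinearMap.mk₂ k (fun x y => t.1.1 x.1 y.1 + t.2.1.1 x.2 y.2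
        + t.2.2 (qq k A x.1) (qq k B y.2) - t.2.2 (qq k A y.1) (qq k B x.2))
      (fun x x' y => by
        simp only [Prod.fst_add, Prod.snd_add, map_add, LinearMap.add_apply]; ring)
      (fun c x y => by
        simp only [Prod.smul_fst, Prod.smul_snd, map_smul, LinearMap.smul_apply, smul_eq_mul]
        ring)
      (fun x y y' => by
        simp only [Prod.fst_add, Prod.snd_add, map_add, LinearMap.add_apply]; ring)
      (fun c x y => by
        simp only [Prod.smul_fst, Prod.smul_snd, map_smul, LinearMap.smul_apply, smul_eq_mul]
        ring), fun x => by
        simp only [LinearMap.mk₂_apply, t.1.2.1, t.2.1.2.1]; ring, fun x y z => by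
        have h1 := t.1.2.2 x.1 y.1 z.1
        have h2 := t.2.1.2.2 x.2 y.2 z.2
        simp only [LinearMap.mk₂_apply, prod_lie, qq_lie, map_zero, LinearMap.zero_apply]
        linear_combination h1 + h2⟩
  map_add' s t := by
    apply Subtype.ext
    refine LinearMap.ext₂ fun x y => ?_
    simp only [Submodule.coe_add, LinearMap.add_apply, LinearMap.mk₂_apply, Prod.fst_add,
      Prod.snd_add]
    ring
  map_smul' c t := by
    apply Subtype.ext
    refine LinearMap.ext₂ fun x y => ?_
    simp only [Submodule.coe_smul, LinearMap.smul_apply, LinearMap.mk₂_apply, Prod.smul_fst,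
      Prod.smul_snd, smul_eq_mul, RingHom.id_apply]
    ring

theorem asm_apply (t : Z2 k A × Z2 k B × (AbQ k A →ₗ[k] AbQ k B →ₗ[k] k)) (x y : A × B) :
    (asm k A B t).1 x y = t.1.1 x.1 y.1 + t.2.1.1 x.2 y.2
        + t.2.2 (qq k A x.1) (qq k B y.2) - t.2.2 (qq k A y.1) (qq k B x.2) := rfl

theorem asm_inj : Function.Injective (asm k A B) := by
  intro s t ht
  have h : ∀ x y, (asm k A B s).1 x y = (asm k A B t).1 x y := fun x y => by rw [ht]
  simp only [asm_apply] at h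
  refine Prod.ext ?_ (Prod.ext ?_ ?_)
  · apply Subtype.ext
    refine LinearMap.ext₂ fun x y => ?_
    simpa using h (x, 0) (y, 0)
  · apply Subtype.ext
    refine LinearMap.ext₂ fun x y => ?_
    simpa using h (0, x) (0, y)
  · refine LinearMap.ext₂ fun x y => ?_
    obtain ⟨x, rfl⟩ := Submodule.mkQ_surjective _ x
    obtain ⟨y, rfl⟩ := Submodule.mkQ_surjective _ y
    simpa using h (x, 0) (0, y)

theorem asm_surj : Function.Surjective (asm k A B) := by
  intro f
  let iA := LinearMap.inl k A B
  let iB := LinearMap.inr k A B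
  have hA : ∀ x y : A, iA ⁅x, y⁆ = ⁅iA x, iA y⁆ := fun x y => by simp [iA, prod_lie]
  have hB : ∀ x y : B, iB ⁅x, y⁆ = ⁅iB x, iB y⁆ := fun x y => by simp [iB, prod_lie]
  have hAB : ∀ (x : A) (y : B), ⁅iA x, iB y⁆ = 0 := fun x y => by simp [iA, iB, prod_lie]
  have hBA : ∀ (x : A) (y : B), ⁅iB y, iA x⁆ = 0 := fun x y => by simp [iA, iB, prod_lie]
  let m : A →ₗ[k] B →ₗ[k] k := f.1.compl₁₂ iA iB
  have hm1 : ∀ x y b, m ⁅x, y⁆ b = 0 := fun x y b => by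
    have h := f.2.2 (iA x) (iA y) (iB b)
    rw [hAB, hBA, map_zero, map_zero, zero_add, zero_add, Z2.skew f, ← hA] at h
    exact neg_eq_zero.1 h
  have hm2 : ∀ a x y, m a ⁅x, y⁆ = 0 := fun a x y => by
    have h := f.2.2 (iA a) (iB x) (iB y)
    rw [hAB, hBA, map_zero, map_zero, add_zero, add_zero, ← hB] at h
    exact h
  let m1 : A →ₗ[k] AbQ k B →ₗ[k] k :=
    { toFun := fun a => Submodule.liftQ _ (m a) (by
        rw [derived_span, Submodule.span_le]
        rintro _ ⟨x, y, rfl⟩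
        exact hm2 a x y)
      map_add' := fun a a' => by
        apply Submodule.linearMap_qext; ext b; simp
      map_smul' := fun c a => by
        apply Submodule.linearMap_qext; ext b; simp }
  let m2 : AbQ k A →ₗ[k] AbQ k B →ₗ[k] k := Submodule.liftQ _ m1 (by
        rw [derived_span, Submodule.span_le]
        rintro _ ⟨x, y, rfl⟩
        change m1 ⁅x, y⁆ = 0
        apply Submodule.linearMap_qext; ext b
        exact hm1 x y b)
  have hm : ∀ a b, m2 (qq k A a) (qq k B b) = f.1 (iA a) (iB b) := fun a b => rfl
  refine ⟨(⟨f.1.compl₁₂ iA iA, fun x => f.2.1 _, fun x y z => ?_⟩,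
    ⟨f.1.compl₁₂ iB iB, fun x => f.2.1 _, fun x y z => ?_⟩, m2), ?_⟩
  · simp only [LinearMap.compl₁₂_apply, hA]
    exact f.2.2 _ _ _
  · simp only [LinearMap.compl₁₂_apply, hB]
    exact f.2.2 _ _ _
  · apply Subtype.ext
    refine LinearMap.ext₂ fun x y => ?_
    rw [asm_apply]
    simp only [hm, LinearMap.compl₁₂_apply]
    have hx : x = iA x.1 + iB x.2 := by simp [iA, iB]
    have hy : y = iA y.1 + iB y.2 := by simp [iA, iB]
    conv_rhs => rw [hx, hy]
    simp only [map_add, LinearMap.add_apply]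
    rw [Z2.skew f (iB x.2) (iA y.1)]
    ring

end ProdPart

theorem stmt1 (k : Type*) [Field k] (A B : Type*) [LieRing A] [LieAlgebra k A]
    [LieRing B] [LieAlgebra k B] [FiniteDimensional k A] [FiniteDimensional k B] :
    schurMultDim k (A × B) = schurMultDim k A + schurMultDim k B +
      finrank k (TensorProduct k (A ⧸ derivedIdeal k A) (B ⧸ derivedIdeal k B)) := by
  have hA := schur_key k A
  have hB := schur_key k B
  have hP := schur_key k (A × B)
  let e := LinearEquiv.ofBijective (asm k A B) ⟨asm_inj, asm_surj⟩
  have hT : finrank k (TensorProduct k (A ⧸ derivedIdeal k A) (B ⧸ derivedIdeal k B)) =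
      finrank k (AbQ k A →ₗ[k] AbQ k B →ₗ[k] k) := by
    rw [(TensorProduct.lift.equiv (RingHom.id k) (AbQ k A) (AbQ k B) k).finrank_eq]
    exact (Subspace.dual_finrank_eq).symm
  have hD : finrank k (derivedIdeal k (A × B)).toSubmodule =
      finrank k (derivedIdeal k A).toSubmodule + finrank k (derivedIdeal k B).toSubmodule := by
    rw [derived_prod, ← Module.finrank_prod]
    exact LinearEquiv.finrank_eq
      { toFun := fun x => (⟨x.1.1, x.2.1⟩, ⟨x.1.2, x.2.2⟩)
        invFun := fun x => ⟨(x.1.1, x.2.1), x.1.2, x.2.2⟩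
        map_add' := fun _ _ => rfl
        map_smul' := fun _ _ => rfl
        left_inv := fun _ => rfl
        right_inv := fun _ => rfl }
  rw [← e.finrank_eq, Module.finrank_prod, Module.finrank_prod, ← hT] at hP
  omega
end

section
/- Let L = H(1) ⊕ A where H(1) is the 3-dimensional Heisenberg Lie algebra and A is abelian of dimension n − 3. Then dim M(L) = n(n−3)/2 + 2 = (n−1)(n−2)/2 + 1. -/
open Module

section Hopf
variable (k : Type*) [Field k] (L : Type*) [LieRing L] [LieAlgebra k L]
variable {N : Type*} [AddCommGroup N] [Module k N]

/-- The wedge `x ∧ y`. -/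
noncomputable def wdg : L →ₗ[k] L →ₗ[k] (⋀[k]^2 L) :=
  LinearMap.mk₂ k (fun x y => exteriorPower.ιMulti k 2 ![x, y])
    (fun x x' y => by
      have := (exteriorPower.ιMulti k 2 (M := L)).map_update_add ![x, y] 0 x x'
      have e : ∀ t, Function.update ![x, y] 0 t = ![t, y] := fun t => by
        ext i; fin_cases i <;> rfl
      rwa [e, e, e] at this)
    (fun c x y => by
      have := (exteriorPower.ιMulti k 2 (M := L)).map_update_smul ![x, y] 0 c x
      have e : ∀ t, Function.update ![x, y] 0 t = ![t, y] := fun t => by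
        ext i; fin_cases i <;> rfl
      rwa [e, e] at this)
    (fun x y y' => by
      have := (exteriorPower.ιMulti k 2 (M := L)).map_update_add ![x, y] 1 y y'
      have e : ∀ t, Function.update ![x, y] 1 t = ![x, t] := fun t => by
        ext i; fin_cases i <;> rfl
      rwa [e, e, e] at this)
    (fun c x y => by
      have := (exteriorPower.ιMulti k 2 (M := L)).map_update_smul ![x, y] 1 c y
      have e : ∀ t, Function.update ![x, y] 1 t = ![x, t] := fun t => by
        ext i; fin_cases i <;> rfl
      rwa [e, e] at this)

theorem wdg_apply (x y : L) : wdg k L x y = exteriorPower.ιMulti k 2 ![x, y] := rfl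

theorem wdg_self (x : L) : wdg k L x x = 0 := by
  rw [wdg_apply]
  exact (exteriorPower.ιMulti k 2 (M := L)).map_eq_zero_of_eq ![x, x] (i := 0) (j := 1)
    (by simp) (by simp)

theorem wdg_span : Submodule.span k {w | ∃ x y, wdg k L x y = w} = ⊤ := by
  rw [eq_top_iff, ← exteriorPower.ιMulti_span k 2 L]
  apply Submodule.span_mono
  rintro _ ⟨v, rfl⟩
  refine ⟨v 0, v 1, ?_⟩
  rw [wdg_apply]
  congr 1
  ext i; fin_cases i <;> rfl

variable {k L}

/-- The linear map on the exterior square induced by an alternating bilinear map. -/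
noncomputable def altLift (B : L →ₗ[k] L →ₗ[k] N) (h : ∀ x, B x x = 0) : (⋀[k]^2 L) →ₗ[k] N :=
  exteriorPower.alternatingMapLinearEquiv
    { toFun := fun v => B (v 0) (v 1)
      map_update_add' := by
        intro _ m i x y
        fin_cases i <;> simp [Function.update]
      map_update_smul' := by
        intro _ m i c x
        fin_cases i <;> simp [Function.update]
      map_eq_zero_of_eq' := by
        intro v i j hv hij
        fin_cases i <;> fin_cases j <;> simp_all }

theorem altLift_wdg (B : L →ₗ[k] L →ₗ[k] N) (h : ∀ x, B x x = 0) (x y : L) :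
    altLift B h (wdg k L x y) = B x y := by
  rw [wdg_apply, altLift, exteriorPower.alternatingMapLinearEquiv_apply_ιMulti]
  simp

variable (k L)

/-- The Jacobi relations in the exterior square. -/
noncomputable def jac : Submodule k (⋀[k]^2 L) :=
  Submodule.span k {w | ∃ x y z : L,
    wdg k L x ⁅y, z⁆ + wdg k L y ⁅z, x⁆ + wdg k L z ⁅x, y⁆ = w}

/-- The (nonabelian) exterior square of a Lie algebra. -/
abbrev QQ := (⋀[k]^2 L) ⧸ jac k L

/-- The universal bracket. -/
noncomputable def br : L →ₗ[k] L →ₗ[k] QQ k L := (wdg k L).compr₂ (jac k L).mkQ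

theorem br_self (x : L) : br k L x x = 0 := by simp [br, wdg_self]

theorem br_skew (x y : L) : br k L x y = - br k L y x := by
  have := br_self k L (x + y)
  simp only [map_add, LinearMap.add_apply, br_self, zero_add, add_zero] at this
  exact eq_neg_of_add_eq_zero_right this

theorem br_jac (x y z : L) : br k L x ⁅y, z⁆ + br k L y ⁅z, x⁆ + br k L z ⁅x, y⁆ = 0 := by
  have : wdg k L x ⁅y, z⁆ + wdg k L y ⁅z, x⁆ + wdg k L z ⁅x, y⁆ ∈ jac k L :=
    Submodule.subset_span ⟨x, y, z, rfl⟩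
  rw [← Submodule.Quotient.mk_eq_zero] at this
  exact this

theorem br_span : Submodule.span k {w | ∃ x y, br k L x y = w} = ⊤ := by
  have h := congrArg (Submodule.map (jac k L).mkQ) (wdg_span k L)
  rw [Submodule.map_span, Submodule.map_top, Submodule.range_mkQ] at h
  rw [← h]
  congr 1
  ext w
  constructor
  · rintro ⟨x, y, rfl⟩; exact ⟨_, ⟨x, y, rfl⟩, rfl⟩
  · rintro ⟨_, ⟨x, y, rfl⟩, rfl⟩; exact ⟨x, y, rfl⟩

/-- Lifting alternating maps satisfying the Jacobi relation. -/
theorem exists_lift (B : L →ₗ[k] L →ₗ[k] N) (h : ∀ x, B x x = 0)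
    (hj : ∀ x y z, B x ⁅y, z⁆ + B y ⁅z, x⁆ + B z ⁅x, y⁆ = 0) :
    ∃ f : QQ k L →ₗ[k] N, ∀ x y, f (br k L x y) = B x y := by
  refine ⟨(jac k L).liftQ (altLift B h) ?_, fun x y => ?_⟩
  · rw [jac, Submodule.span_le]
    rintro _ ⟨x, y, z, rfl⟩
    simp [altLift_wdg, hj]
  · exact altLift_wdg B h x y

/-- The central extension `L × QQ` of `L`. -/
def Cov := L × QQ k L

noncomputable instance : AddCommGroup (Cov k L) := inferInstanceAs (AddCommGroup (L × QQ k L))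
noncomputable instance : Module k (Cov k L) := inferInstanceAs (Module k (L × QQ k L))

noncomputable instance : Bracket (Cov k L) (Cov k L) :=
  ⟨fun a b => ((⁅a.1, b.1⁆, br k L a.1 b.1) : L × QQ k L)⟩

variable {k L}
theorem Cov.lie_fst (a b : Cov k L) : (⁅a, b⁆ : Cov k L).1 = ⁅a.1, b.1⁆ := rfl
theorem Cov.lie_snd (a b : Cov k L) : (⁅a, b⁆ : Cov k L).2 = br k L a.1 b.1 := rfl
theorem Cov.add_fst (a b : Cov k L) : (a + b).1 = a.1 + b.1 := rfl
theorem Cov.add_snd (a b : Cov k L) : (a + b).2 = a.2 + b.2 := rfl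
theorem Cov.zero_fst : (0 : Cov k L).1 = 0 := rfl
theorem Cov.zero_snd : (0 : Cov k L).2 = 0 := rfl
theorem Cov.smul_fst (c : k) (b : Cov k L) : (c • b).1 = c • b.1 := rfl
theorem Cov.smul_snd (c : k) (b : Cov k L) : (c • b).2 = c • b.2 := rfl
theorem Cov.ext' {a b : Cov k L} (h1 : a.1 = b.1) (h2 : a.2 = b.2) : a = b := Prod.ext h1 h2
variable (k L)

noncomputable instance : LieRing (Cov k L) where
  add_lie x y z := by
    apply Cov.ext' <;> simp [Cov.lie_fst, Cov.lie_snd, Cov.add_fst, Cov.add_snd]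
  lie_add x y z := by
    apply Cov.ext' <;> simp [Cov.lie_fst, Cov.lie_snd, Cov.add_fst, Cov.add_snd]
  lie_self x := by
    apply Cov.ext' <;> simp [Cov.lie_fst, Cov.lie_snd, Cov.zero_fst, Cov.zero_snd, br_self]
  leibniz_lie x y z := by
    apply Cov.ext'
    · simp [Cov.lie_fst, Cov.add_fst]
    · simp only [Cov.lie_fst, Cov.lie_snd, Cov.add_snd]
      have := br_jac k L x.1 y.1 z.1
      rw [br_skew k L ⁅x.1, y.1⁆, ← lie_skew x.1 z.1, map_neg]
      rw [← lie_skew z.1 x.1, map_neg] at this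
      rw [← sub_eq_zero, ← this, ← lie_skew z.1 x.1, map_neg]
      abel

noncomputable instance : LieAlgebra k (Cov k L) where
  lie_smul t x y := by
    apply Cov.ext' <;> simp [Cov.lie_fst, Cov.lie_snd, Cov.smul_fst, Cov.smul_snd]

/-- The lift of the free Lie algebra to the extension. -/
noncomputable def phi : FreeLieAlgebra k L →ₗ⁅k⁆ Cov k L :=
  FreeLieAlgebra.lift k (fun x => ((x, 0) : L × QQ k L))

/-- First projection. -/
noncomputable def covFst : Cov k L →ₗ⁅k⁆ L where
  toFun a := a.1
  map_add' _ _ := rfl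
  map_smul' _ _ := rfl
  map_lie' := rfl

/-- Second projection. -/
noncomputable def covSnd : Cov k L →ₗ[k] QQ k L where
  toFun a := a.2
  map_add' _ _ := rfl
  map_smul' _ _ := rfl

theorem phi_fst (f : FreeLieAlgebra k L) : (phi k L f).1 = presPi k L f := by
  have : (covFst k L).comp (phi k L) = presPi k L := by
    apply FreeLieAlgebra.hom_ext
    intro x
    have h1 : phi k L (FreeLieAlgebra.of k x) = ((x, 0) : L × QQ k L) :=
      FreeLieAlgebra.lift_of_apply (R := k) (L := Cov k L) (fun x => ((x, 0) : L × QQ k L)) x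
    have h2 : presPi k L (FreeLieAlgebra.of k x) = x := FreeLieAlgebra.lift_of_apply (R := k) _ x
    rw [h2]
    exact congrArg (covFst k L) h1
  exact congrArg (fun g : FreeLieAlgebra k L →ₗ⁅k⁆ L => g f) this

/-- Second component of `phi`. -/
noncomputable def psi : FreeLieAlgebra k L →ₗ[k] QQ k L :=
  (covSnd k L) ∘ₗ (phi k L : FreeLieAlgebra k L →ₗ[k] Cov k L)

theorem psi_lie (f g : FreeLieAlgebra k L) :
    psi k L ⁅f, g⁆ = br k L (presPi k L f) (presPi k L g) := by
  rw [← phi_fst, ← phi_fst, ← Cov.lie_snd, ← LieHom.map_lie]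
  rfl

theorem presPi_surj : Function.Surjective (presPi k L) := fun x =>
  ⟨FreeLieAlgebra.of k x, by simp [presPi]⟩

theorem exists_beta : ∃ β : QQ k L →ₗ[k] L, ∀ x y, β (br k L x y) = ⁅x, y⁆ := by
  refine exists_lift k L (LieModule.toEnd k L L : L →ₗ[k] L →ₗ[k] L) (by simp) ?_
  intro x y z
  simpa using lie_jacobi x y z

theorem F2_span : LieSubmodule.toSubmodule ⁅(⊤ : LieIdeal k L), (⊤ : LieIdeal k L)⁆ =
    Submodule.span k {w | ∃ x y : L, ⁅x, y⁆ = w} := by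
  rw [LieSubmodule.lieIdeal_oper_eq_linear_span']
  simp

theorem lie_congr_den {f f' g g' : FreeLieAlgebra k L} (hf : presPi k L f = presPi k L f')
    (hg : presPi k L g = presPi k L g') : ⁅f, g⁆ - ⁅f', g'⁆ ∈ multDen k L := by
  have h1 : ⁅f - f', g⁆ ∈ multDen k L :=
    LieSubmodule.lie_mem_lie (by simp [hf]) (LieSubmodule.mem_top _)
  have h2 : ⁅g - g', f'⁆ ∈ multDen k L :=
    LieSubmodule.lie_mem_lie (by simp [hg]) (LieSubmodule.mem_top _)
  have := sub_mem h1 h2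
  convert this using 1
  rw [← lie_skew (g - g') f', sub_lie, lie_sub]
  abel

theorem exists_theta : ∃ θ : QQ k L →ₗ[k] (FreeLieAlgebra k L ⧸ (multDen k L).toSubmodule),
    ∀ f g, θ (br k L (presPi k L f) (presPi k L g)) = (multDen k L).toSubmodule.mkQ ⁅f, g⁆ := by
  obtain ⟨s, hs⟩ := LinearMap.exists_rightInverse_of_surjective
    (presPi k L : FreeLieAlgebra k L →ₗ[k] L) (LinearMap.range_eq_top.2 (presPi_surj k L))
  have hs' : ∀ x, presPi k L (s x) = x := fun x => LinearMap.congr_fun hs x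
  let B : L →ₗ[k] L →ₗ[k] (FreeLieAlgebra k L ⧸ (multDen k L).toSubmodule) :=
    ((LieModule.toEnd k (FreeLieAlgebra k L) (FreeLieAlgebra k L) :
      FreeLieAlgebra k L →ₗ[k] FreeLieAlgebra k L →ₗ[k] FreeLieAlgebra k L).compl₁₂ s s).compr₂
        (multDen k L).toSubmodule.mkQ
  have hB : ∀ x y, B x y = (multDen k L).toSubmodule.mkQ ⁅s x, s y⁆ := fun x y => rfl
  have hB' : ∀ f g, B (presPi k L f) (presPi k L g) = (multDen k L).toSubmodule.mkQ ⁅f, g⁆ := by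
    intro f g
    rw [hB, ← sub_eq_zero, ← map_sub]
    refine (Submodule.Quotient.mk_eq_zero _).2 ?_
    exact lie_congr_den k L (hs' _) (hs' _)
  obtain ⟨θ, hθ⟩ := exists_lift k L B (fun x => by rw [hB]; simp) (by
    intro x y z
    have e : ∀ x y z, B x ⁅y, z⁆ = (multDen k L).toSubmodule.mkQ ⁅s x, ⁅s y, s z⁆⁆ := by
      intro x y z
      rw [← hB']
      simp [hs']
    rw [e, e, e, ← map_add, ← map_add, lie_jacobi, map_zero])
  exact ⟨θ, fun f g => by rw [hθ, hB']⟩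

theorem finrank_schur (β : QQ k L →ₗ[k] L) (hβ : ∀ x y, β (br k L x y) = ⁅x, y⁆) :
    schurMultDim k L = finrank k (LinearMap.ker β) := by
  obtain ⟨θ, hθ⟩ := exists_theta k L
  have hF2 : ∀ f ∈ ⁅(⊤ : LieIdeal k (FreeLieAlgebra k L)), (⊤ : LieIdeal k (FreeLieAlgebra k L))⁆,
      β (psi k L f) = presPi k L f ∧ θ (psi k L f) = (multDen k L).toSubmodule.mkQ f := by
    intro f hf
    rw [← LieSubmodule.mem_toSubmodule, F2_span] at hf
    induction hf using Submodule.span_induction with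
    | mem f h => obtain ⟨x, y, rfl⟩ := h; rw [psi_lie, hβ, hθ]; simp
    | zero => simp
    | add x y _ _ h1 h2 => simp only [map_add, h1, h2, and_self]
    | smul c x _ h => simp only [map_smul, h, and_self]
  let g : (multNum k L).toSubmodule →ₗ[k] LinearMap.ker β :=
    LinearMap.codRestrict _ (psi k L ∘ₗ (multNum k L).toSubmodule.subtype) (by
      rintro ⟨f, hf⟩
      have hf' : f ∈ multNum k L := hf
      rw [multNum, LieSubmodule.mem_inf] at hf'
      simp only [LinearMap.mem_ker, LinearMap.comp_apply, Submodule.subtype_apply]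
      rw [(hF2 f hf'.2).1]
      exact (LieHom.mem_ker).1 hf'.1)
  have hg : ∀ f, ((g f : LinearMap.ker β) : QQ k L) = psi k L f.1 := fun f => rfl
  have hsurj : Function.Surjective g := by
    rintro ⟨q, hq⟩
    have : ∃ f ∈ ⁅(⊤ : LieIdeal k (FreeLieAlgebra k L)), (⊤ : LieIdeal k (FreeLieAlgebra k L))⁆,
        psi k L f = q := by
      have hq' : q ∈ Submodule.span k {w | ∃ x y, br k L x y = w} := by rw [br_span]; trivial
      clear hq
      induction hq' using Submodule.span_induction with
      | mem f h =>
        obtain ⟨x, y, rfl⟩ := h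
        obtain ⟨x, rfl⟩ := presPi_surj k L x
        obtain ⟨y, rfl⟩ := presPi_surj k L y
        exact ⟨⁅x, y⁆, LieSubmodule.lie_mem_lie (LieSubmodule.mem_top _) (LieSubmodule.mem_top _),
          psi_lie k L x y⟩
      | zero => exact ⟨0, zero_mem _, map_zero _⟩
      | add x y _ _ h1 h2 =>
        obtain ⟨a, ha, rfl⟩ := h1
        obtain ⟨b, hb, rfl⟩ := h2
        exact ⟨a + b, add_mem ha hb, map_add _ _ _⟩
      | smul c x _ h =>
        obtain ⟨a, ha, rfl⟩ := h
        exact ⟨c • a, Submodule.smul_mem _ c ha, map_smul _ _ _⟩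
    obtain ⟨f, hf, rfl⟩ := this
    have hk : f ∈ (presPi k L).ker := by
      rw [LieHom.mem_ker, ← (hF2 f hf).1]; exact hq
    refine ⟨⟨f, ?_⟩, Subtype.ext rfl⟩
    change f ∈ multNum k L
    rw [multNum, LieSubmodule.mem_inf]
    exact ⟨hk, hf⟩
  have hker : LinearMap.ker g = Submodule.comap (multNum k L).toSubmodule.subtype
      (multDen k L).toSubmodule := by
    ext ⟨f, hf⟩
    have hf' : f ∈ multNum k L := hf
    rw [multNum, LieSubmodule.mem_inf] at hf'
    rw [LinearMap.mem_ker, ← Subtype.coe_inj, hg, Submodule.mem_comap]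
    simp only [Submodule.subtype_apply, ZeroMemClass.coe_zero]
    constructor
    · intro h
      have h2 := (hF2 f hf'.2).2
      rw [h, map_zero] at h2
      exact (Submodule.Quotient.mk_eq_zero _).1 h2.symm
    · intro h
      rw [multDen, LieSubmodule.lieIdeal_oper_eq_linear_span'] at h
      clear hf hf'
      induction h using Submodule.span_induction with
      | mem f h =>
        obtain ⟨x, hx, y, -, rfl⟩ := h
        rw [psi_lie, LieHom.mem_ker.1 hx]; simp
      | zero => simp
      | add x y _ _ h1 h2 => simp only [map_add, h1, h2, add_zero]
      | smul c x _ h => simp only [map_smul, h, smul_zero]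
  have e := (Submodule.quotEquivOfEq _ _ hker).symm.trans (g.quotKerEquivOfSurjective hsurj)
  exact e.finrank_eq

end Hopf

section Heis
variable {k : Type*} [Field k] {H A : Type*} [LieRing H] [LieAlgebra k H]
    [FiniteDimensional k H] [LieRing A] [LieAlgebra k A] [FiniteDimensional k A]

theorem prod_lie_eq (x y : H × A) : ⁅x, y⁆ = (⁅x.1, y.1⁆, ⁅x.2, y.2⁆) := rfl


theorem heis_structure (hH3 : finrank k H = 3)
    (hHc : derivedIdeal k H = LieAlgebra.center k H)
    (hH1 : finrank k ↥(derivedIdeal k H) = 1) :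
    ∃ x y z : H, z ≠ 0 ∧ ⁅x, y⁆ = z ∧ (∀ t : H, ⁅t, z⁆ = 0) ∧
      ∀ t : H, ∃ a b c : k, t = a • x + b • y + c • z := by
  obtain ⟨⟨z₀, hz₀⟩, hne, hsp⟩ := finrank_eq_one_iff'.1 hH1
  have hz₀' : z₀ ≠ 0 := fun h => hne (Subtype.ext h)
  have hbr : ∀ x y : H, ∃ c : k, c • z₀ = ⁅x, y⁆ := by
    intro x y
    obtain ⟨c, hc⟩ := hsp ⟨⁅x, y⁆, LieSubmodule.lie_mem_lie (LieSubmodule.mem_top _)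
      (LieSubmodule.mem_top _)⟩
    exact ⟨c, congrArg Subtype.val hc⟩
  have hex : ∃ x y : H, ⁅x, y⁆ ≠ 0 := by
    by_contra! hcon
    apply hz₀'
    have h : z₀ ∈ LieSubmodule.toSubmodule (derivedIdeal k H) := hz₀
    rw [derivedIdeal, F2_span] at h
    have hle : Submodule.span k {w | ∃ x y : H, ⁅x, y⁆ = w} ≤ ⊥ := by
      rw [Submodule.span_le]
      rintro _ ⟨x, y, rfl⟩
      exact hcon x y
    exact (Submodule.mem_bot k).1 (hle h)
  obtain ⟨x, y, hxy⟩ := hex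
  obtain ⟨c, hc⟩ := hbr x y
  have hcent : ∀ t : H, ⁅t, ⁅x, y⁆⁆ = 0 := by
    intro t
    have h : ⁅x, y⁆ ∈ derivedIdeal k H :=
      LieSubmodule.lie_mem_lie (LieSubmodule.mem_top _) (LieSubmodule.mem_top _)
    rw [hHc, LieModule.mem_maxTrivSubmodule] at h
    exact h t
  refine ⟨x, y, ⁅x, y⁆, hxy, rfl, hcent, ?_⟩
  have hli : LinearIndependent k ![x, y, ⁅x, y⁆] := by
    rw [Fintype.linearIndependent_iff]
    intro g hg
    simp only [Fin.sum_univ_three, Matrix.cons_val_zero, Matrix.cons_val_one,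
      Matrix.cons_val] at hg
    have h1 := congrArg (fun t => ⁅x, t⁆) hg
    have h0 := congrArg (fun t => ⁅y, t⁆) hg
    simp only [lie_add, lie_smul, lie_self, smul_zero, lie_zero, hcent, zero_add, add_zero] at h1 h0
    have e1 : g 1 = 0 := (smul_eq_zero.1 h1).resolve_right hxy
    have e0 : g 0 = 0 := by
      rw [← lie_skew, smul_neg, neg_eq_zero] at h0
      exact (smul_eq_zero.1 h0).resolve_right hxy
    rw [e0, e1, zero_smul, zero_smul, zero_add, zero_add] at hg
    have e2 : g 2 = 0 := (smul_eq_zero.1 hg).resolve_right hxy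
    intro i; fin_cases i <;> assumption
  have hspan := hli.span_eq_top_of_card_eq_finrank' (by simp [hH3])
  intro t
  have ht : t ∈ Submodule.span k (Set.range ![x, y, ⁅x, y⁆]) := by rw [hspan]; trivial
  rw [Submodule.mem_span_range_iff_exists_fun] at ht
  obtain ⟨g, rfl⟩ := ht
  exact ⟨g 0, g 1, g 2, by simp [Fin.sum_univ_three]⟩

theorem jac_eq (hA : IsLieAbelian A) {x y z : H} (hxy : ⁅x, y⁆ = z) (hz : ∀ t : H, ⁅t, z⁆ = 0)
    (hsp : ∀ t : H, ∃ a b c : k, t = a • x + b • y + c • z) :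
    jac k (H × A) = LinearMap.range
      (((wdg k (H × A)).flip (z, 0)) ∘ₗ (LinearMap.inr k H A)) := by
  have hyx : ⁅y, x⁆ = -z := by rw [← hxy, lie_skew]
  have hz' : ∀ t : H, ⁅z, t⁆ = 0 := fun t => by rw [← lie_skew, hz, neg_zero]
  have hbr : ∀ a b c a' b' c' : k, ⁅a • x + b • y + c • z, a' • x + b' • y + c' • z⁆ =
      (a * b' - b * a') • z := by
    intro a b c a' b' c'
    simp only [lie_add, add_lie, lie_smul, smul_lie, lie_self, hz, hz', hxy, hyx]
    module
  apply le_antisymm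
  · rw [jac, Submodule.span_le]
    rintro _ ⟨⟨u, p⟩, ⟨v, q⟩, ⟨w, r⟩, rfl⟩
    obtain ⟨a, b, c, rfl⟩ := hsp u
    obtain ⟨a', b', c', rfl⟩ := hsp v
    obtain ⟨a'', b'', c'', rfl⟩ := hsp w
    have hb : ∀ (s : k), ((s • z, 0) : H × A) = s • ((z, 0) : H × A) := fun s => by simp
    simp only [prod_lie_eq, hbr, trivial_lie_zero, hb, map_smul]
    refine ⟨(a' * b'' - b' * a'') • p + (a'' * b - b'' * a) • q + (a * b' - b * a') • r, ?_⟩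
    have key : (a' * b'' - b' * a'') • ((a • x + b • y + c • z, p) : H × A)
        + (a'' * b - b'' * a) • ((a' • x + b' • y + c' • z, q) : H × A)
        + (a * b' - b * a') • ((a'' • x + b'' • y + c'' • z, r) : H × A)
        = LinearMap.inr k H A
          ((a' * b'' - b' * a'') • p + (a'' * b - b'' * a) • q + (a * b' - b * a') • r)
        + ((a' * b'' - b' * a'') * c + (a'' * b - b'' * a) * c' + (a * b' - b * a') * c'') •
          ((z, 0) : H × A) := by
      ext
      · simp only [Prod.fst_add, Prod.smul_fst, LinearMap.inr_apply]
        module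
      · simp
    have k2 := congrArg (fun t => wdg k (H × A) t (z, 0)) key
    simp only [map_add, map_smul, LinearMap.add_apply, LinearMap.smul_apply, wdg_self, smul_zero,
      add_zero] at k2
    rw [k2]
    simp only [LinearMap.comp_apply, LinearMap.flip_apply, map_add, map_smul, LinearMap.add_apply,
      LinearMap.smul_apply]
  · rintro _ ⟨a, rfl⟩
    apply Submodule.subset_span
    refine ⟨(0, a), (x, 0), (y, 0), ?_⟩
    have e0 : ((0, 0) : H × A) = 0 := rfl
    simp [hxy, e0]

theorem wz_inj {z : H} (hz : z ≠ 0) : Function.Injective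
      (((wdg k (H × A)).flip (z, 0)) ∘ₗ (LinearMap.inr k H A)) := by
  obtain ⟨φ, hφ⟩ : ∃ φ : Module.Dual k H, φ z ≠ 0 := by
    by_contra! h
    exact hz ((Module.forall_dual_apply_eq_zero_iff k z).1 h)
  let C : (H × A) →ₗ[k] (H × A) →ₗ[k] A := LinearMap.mk₂ k
    (fun u v => φ v.1 • u.2 - φ u.1 • v.2)
    (fun u u' v => by simp only [Prod.snd_add, Prod.fst_add, map_add]; module)
    (fun s u v => by simp only [Prod.smul_snd, Prod.smul_fst, map_smul, smul_eq_mul]; module)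
    (fun u v v' => by simp only [Prod.snd_add, Prod.fst_add, map_add]; module)
    (fun s u v => by simp only [Prod.smul_snd, Prod.smul_fst, map_smul, smul_eq_mul]; module)
  have hC : ∀ u, C u u = 0 := fun u => by simp [C]
  intro a b hab
  have h := congrArg (altLift C hC) hab
  simp only [LinearMap.comp_apply, LinearMap.flip_apply, altLift_wdg] at h
  simp only [C, LinearMap.mk₂_apply, LinearMap.inr_apply, map_zero, zero_smul, sub_zero] at h
  exact smul_right_injective A hφ h

theorem schur_heis (hA : IsLieAbelian A) (hH3 : finrank k H = 3)
    (hHc : derivedIdeal k H = LieAlgebra.center k H)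
    (hH1 : finrank k ↥(derivedIdeal k H) = 1) :
    schurMultDim k (H × A) + 1 + finrank k A = (3 + finrank k A).choose 2 := by
  obtain ⟨x, y, z, hz0, hxy, hz, hsp⟩ := heis_structure hH3 hHc hH1
  obtain ⟨β, hβ⟩ := exists_beta k (H × A)
  rw [finrank_schur k (H × A) β hβ]
  have h1 : LinearMap.range β = Submodule.span k {((z, 0) : H × A)} := by
    rw [LinearMap.range_eq_map, ← br_span, Submodule.map_span]
    apply le_antisymm
    · rw [Submodule.span_le]
      rintro _ ⟨_, ⟨⟨u, p⟩, ⟨v, q⟩, rfl⟩, rfl⟩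
      obtain ⟨a, b, c, rfl⟩ := hsp u
      obtain ⟨a', b', c', rfl⟩ := hsp v
      rw [hβ, SetLike.mem_coe, Submodule.mem_span_singleton]
      refine ⟨a * b' - b * a', ?_⟩
      have hyx : ⁅y, x⁆ = -z := by rw [← hxy, lie_skew]
      have hz' : ∀ t : H, ⁅z, t⁆ = 0 := fun t => by rw [← lie_skew, hz, neg_zero]
      ext
      · simp only [prod_lie_eq, lie_add, add_lie, lie_smul, smul_lie, lie_self, hz, hz', hxy, hyx,
          Prod.smul_fst]
        module
      · simp [trivial_lie_zero]
    · rw [Submodule.span_le, Set.singleton_subset_iff]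
      apply Submodule.subset_span
      exact ⟨_, ⟨(x, 0), (y, 0), rfl⟩, by simp [hβ, hxy]⟩
  have h2 : finrank k (LinearMap.range β) = 1 := by
    rw [h1]; exact finrank_span_singleton (by simpa using hz0)
  have h3 := LinearMap.finrank_range_add_finrank_ker β
  have h4 := Submodule.finrank_quotient_add_finrank (jac k (H × A))
  have h5 : finrank k (jac k (H × A)) = finrank k A := by
    rw [jac_eq hA hxy hz hsp, LinearMap.finrank_range_of_inj (wz_inj hz0)]
  have h6 : finrank k (⋀[k]^2 (H × A)) = (3 + finrank k A).choose 2 := by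
    rw [exteriorPower.finrank_eq, finrank_prod, hH3]
  rw [h5] at h4
  have h7 : finrank k (QQ k (H × A)) + finrank k A = (3 + finrank k A).choose 2 := h4.trans h6
  rw [← h7, ← h3, h2]
  ring

end Heis

theorem stmt12 (k : Type*) [Field k] (H A : Type*) [LieRing H] [LieAlgebra k H]
    [FiniteDimensional k H] [LieRing A] [LieAlgebra k A] [FiniteDimensional k A]
    (n : ℕ) (hn : 3 ≤ n)
    (hH3 : finrank k H = 3)
    (hHc : derivedIdeal k H = LieAlgebra.center k H)
    (hH1 : finrank k ↥(derivedIdeal k H) = 1)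
    (hA : IsLieAbelian A) (hAdim : finrank k A = n - 3) :
    schurMultDim k (H × A) = n * (n - 3) / 2 + 2 ∧
      n * (n - 3) / 2 + 2 = (n - 1) * (n - 2) / 2 + 1 := by
  have h := schur_heis (k := k) (H := H) hA hH3 hHc hH1
  rw [hAdim] at h
  obtain ⟨m, rfl⟩ := Nat.exists_eq_add_of_le hn
  have e1 : 3 + m - 3 = m := by omega
  have e2 : 3 + m - 1 = m + 2 := by omega
  have e3 : 3 + m - 2 = m + 1 := by omega
  rw [e1, Nat.choose_two_right, e2] at h
  rw [e1, e2, e3]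
  obtain ⟨j, hj⟩ : ∃ j, m * (m + 1) = 2 * j := (Nat.even_mul_succ_self m).two_dvd
  have a1 : (3 + m) * m = 2 * (j + m) := by linarith
  have a2 : (m + 2) * (m + 1) = 2 * (j + m + 1) := by linarith
  have a3 : (3 + m) * (m + 2) = 2 * (j + 2 * m + 3) := by linarith
  rw [a3] at h
  rw [a1, a2]
  omega
end
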